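/- arXiv:1703.00696 — 11 statements merged into one kernel-verified Lean document; each statement's English description precedes it below -/
import Mathlib

section
/- Let A, Δ, B be n×n complex matrices with A and Δ Hermitian positive semidefinite and B Hermitian positive definite. Then det(A+B)/det(B) ≥ det(A+B+Δ)/det(B+Δ), where all four determinants are positive real numbers; equivalently, (det(A+B)).re · (det(B+Δ)).re ≥ (det(A+B+Δ)).re · (det(B)).re. -/
open Matrix ComplexOrder

open scoped MatrixOrder Matrix.Norms.L2Operator in
theorem aux_factor {n : ℕ} (A : Matrix (Fin n) (Fin n) ℂ) (hA : A.PosSemidef) :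
    ∃ C : Matrix (Fin n) (Fin n) ℂ, A = Cᴴ * C :=
  CStarAlgebra.nonneg_iff_eq_star_mul_self.mp hA.nonneg

theorem aux_one_le {n : ℕ} (M : Matrix (Fin n) (Fin n) ℂ) (hM : M.PosSemidef) :
    1 ≤ (1 + M).det := by
  have h : (1 + M).det = ∏ i, (1 + (hM.1.eigenvalues i : ℂ)) := by
    conv_lhs => rw [hM.1.spectral_theorem, Unitary.conjStarAlgAut_apply, mul_assoc,
      det_one_add_mul_comm, mul_assoc, Unitary.coe_star_mul_self, mul_one,
      ← diagonal_one, diagonal_add, det_diagonal]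
    rfl
  rw [h]
  have h2 : (1 : ℝ) ≤ ∏ i, (1 + hM.1.eigenvalues i) :=
    (Finset.prod_const_one (s := Finset.univ)).symm.le.trans (Finset.prod_le_prod (fun _ _ => zero_le_one) fun i _ => by linarith [hM.eigenvalues_nonneg i])
  exact_mod_cast h2

theorem aux_mono {n : ℕ} (P Q : Matrix (Fin n) (Fin n) ℂ) (hP : P.PosDef) (hQ : Q.PosSemidef) :
    P.det ≤ (P + Q).det := by
  obtain ⟨D, rfl⟩ := aux_factor Q hQ
  rw [det_add_mul _ _ hP.det_pos.ne'.isUnit]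
  exact le_mul_of_one_le_right hP.det_pos.le
    (aux_one_le _ (hP.inv.posSemidef.mul_mul_conjTranspose_same D))

theorem aux_inv {n : ℕ} (B Δ : Matrix (Fin n) (Fin n) ℂ) (hB : B.PosDef) (hΔ : Δ.PosSemidef) :
    ∃ R : Matrix (Fin n) (Fin n) ℂ, R.PosSemidef ∧ B⁻¹ = (B + Δ)⁻¹ + R := by
  obtain ⟨D, rfl⟩ := aux_factor Δ hΔ
  have hS : (1 + D * B⁻¹ * Dᴴ).PosDef :=
    PosDef.one.add_posSemidef (hB.inv.posSemidef.mul_mul_conjTranspose_same D)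
  have h := add_mul_mul_inv_eq_sub B Dᴴ 1 D hB.isUnit isUnit_one
    (by rw [inv_one]; exact hS.isUnit)
  rw [inv_one, mul_one] at h
  refine ⟨_, ?_, by rw [h, sub_add_cancel]⟩
  have := hS.inv.posSemidef.conjTranspose_mul_mul_same (D * B⁻¹)
  rw [conjTranspose_mul, hB.inv.isHermitian.eq] at this
  simpa only [mul_assoc] using this

/-- Lemma 4 (Weingarten et al.): for PSD `A`, `Δ` and PD `B`,
`det(A+B)/det(B) ≥ det(A+B+Δ)/det(B+Δ)`, stated multiplicatively with real parts. -/
theorem stmt0 {n : ℕ} (A Δ B : Matrix (Fin n) (Fin n) ℂ)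
    (hA : A.PosSemidef) (hΔ : Δ.PosSemidef) (hB : B.PosDef) :
    ((A + B + Δ).det).re * (B.det).re ≤ ((A + B).det).re * ((B + Δ).det).re := by
  have hBΔ : (B + Δ).PosDef := hB.add_posSemidef hΔ
  have h1 : (A + B).PosDef := PosDef.posSemidef_add hA hB
  have h2 : (A + B + Δ).PosDef := h1.add_posSemidef hΔ
  have key : (A + B + Δ).det * B.det ≤ (A + B).det * (B + Δ).det := by
    obtain ⟨R, hR, hinv⟩ := aux_inv B Δ hB hΔ
    obtain ⟨C, rfl⟩ := aux_factor A hA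
    have e1 : Cᴴ * C + B + Δ = (B + Δ) + Cᴴ * C := by abel
    have e2 : Cᴴ * C + B = B + Cᴴ * C := by abel
    rw [e1, e2, det_add_mul _ _ hB.det_pos.ne'.isUnit, det_add_mul _ _ hBΔ.det_pos.ne'.isUnit]
    have hm := aux_mono (1 + C * (B + Δ)⁻¹ * Cᴴ) (C * R * Cᴴ)
      (PosDef.one.add_posSemidef (hBΔ.inv.posSemidef.mul_mul_conjTranspose_same C))
      (hR.mul_mul_conjTranspose_same C)
    have e3 : 1 + C * (B + Δ)⁻¹ * Cᴴ + C * R * Cᴴ = 1 + C * B⁻¹ * Cᴴ := by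
      rw [hinv]; noncomm_ring
    rw [e3] at hm
    calc _ = (B.det * (B + Δ).det) * (1 + C * (B + Δ)⁻¹ * Cᴴ).det := by ring
      _ ≤ (B.det * (B + Δ).det) * (1 + C * B⁻¹ * Cᴴ).det :=
        mul_le_mul_of_nonneg_left hm (mul_nonneg hB.det_pos.le hBΔ.det_pos.le)
      _ = _ := by ring
  have hre := (Complex.le_def.1 key).1
  have i1 := (Complex.lt_def.1 hB.det_pos).2
  have i2 := (Complex.lt_def.1 hBΔ.det_pos).2
  simp only [Complex.zero_im] at i1 i2
  simpa [Complex.mul_re, ← i1, ← i2] using hre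
end

section
/- Let E be an N×N Hermitian positive definite complex matrix. Consider the function f(S) = −Re(trace(S·E)) + logdet(S) + N defined for N×N Hermitian positive definite complex matrices S, where logdet M := Real.log ((Matrix.det M).re). Then logdet(E⁻¹) is the greatest value of f over all Hermitian positive definite S: for every such S one has f(S) ≤ logdet(E⁻¹) (= −logdet(E)), and equality holds at S = E⁻¹, i.e., f(E⁻¹) = logdet(E⁻¹). -/
open Matrix ComplexOrder

/-- `logdet M = log (Re (det M))`. -/
noncomputable def logdet {N : Type*} [Fintype N] [DecidableEq N] (M : Matrix N N ℂ) : ℝ :=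
  Real.log M.det.re

lemma logdet_le_trace {N : ℕ} (A : Matrix (Fin N) (Fin N) ℂ) (hA : A.PosDef) :
    logdet A ≤ A.trace.re - N := by
  have h1 : A.det.re = ∏ i, hA.1.eigenvalues i := by
    rw [hA.1.det_eq_prod_eigenvalues]
    norm_cast
  have h2 : A.trace.re = ∑ i, hA.1.eigenvalues i := by
    rw [hA.1.trace_eq_sum_eigenvalues]
    norm_cast
  rw [logdet, h1, h2, Real.log_prod (fun i _ => (hA.eigenvalues_pos i).ne')]
  have := Finset.sum_le_sum (s := Finset.univ)
    (fun i _ => Real.log_le_sub_one_of_pos (hA.eigenvalues_pos i))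
  simpa [Finset.sum_sub_distrib] using this

open scoped MatrixOrder in
lemma posDef_factor {N : ℕ} (E : Matrix (Fin N) (Fin N) ℂ) (hE : E.PosDef) :
    ∃ B : Matrix (Fin N) (Fin N) ℂ, E = Bᴴ * B := by
  obtain ⟨B, hB⟩ := CStarAlgebra.nonneg_iff_eq_star_mul_self.mp hE.posSemidef.nonneg
  exact ⟨B, hB⟩

lemma logdet_mul' {N : ℕ} (S E : Matrix (Fin N) (Fin N) ℂ) (hS : S.PosDef) (hE : E.PosDef) :
    Real.log (S.det * E.det).re = logdet S + logdet E := by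
  have h1 := Complex.pos_iff.mp hS.det_pos
  have h2 := Complex.pos_iff.mp hE.det_pos
  rw [Complex.mul_re, ← h1.2, ← h2.2, zero_mul, sub_zero,
    Real.log_mul h1.1.ne' h2.1.ne']
  rfl

/-- Lemma 3: variational characterization of the log-determinant.  For Hermitian
positive definite `E`, the function `f(S) = -Re(tr(S E)) + logdet S + N` over Hermitian
positive definite `S` attains its greatest value `logdet E⁻¹ = -logdet E` at `S = E⁻¹`. -/
theorem stmt1 {N : ℕ} (E : Matrix (Fin N) (Fin N) ℂ) (hE : E.PosDef) :
    (∀ S : Matrix (Fin N) (Fin N) ℂ, S.PosDef →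
        -(Matrix.trace (S * E)).re + logdet S + (N : ℝ) ≤ logdet E⁻¹) ∧
      (-(Matrix.trace (E⁻¹ * E)).re + logdet E⁻¹ + (N : ℝ) = logdet E⁻¹) ∧
      logdet E⁻¹ = -logdet E := by
  have hu : IsUnit E.det := hE.det_pos.ne'.isUnit
  have hinv : E⁻¹ * E = 1 := Matrix.nonsing_inv_mul E hu
  have h3 : logdet E⁻¹ = -logdet E := by
    have h := logdet_mul' E⁻¹ E hE.inv hE
    rw [← Matrix.det_mul, hinv] at h
    simp at h
    linarith
  refine ⟨fun S hS => ?_, by rw [hinv]; simp, h3⟩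
  obtain ⟨B, hB⟩ := posDef_factor E hE
  have hBu : IsUnit B := by
    rw [Matrix.isUnit_iff_isUnit_det]
    rw [hB, Matrix.det_mul] at hu
    exact isUnit_of_mul_isUnit_right hu
  have hA : (B * S * Bᴴ).PosDef :=
    hS.mul_mul_conjTranspose_same (Matrix.vecMul_injective_of_isUnit hBu)
  have h := logdet_le_trace _ hA
  have ht : (B * S * Bᴴ).trace = (S * E).trace := by
    rw [hB, Matrix.mul_assoc, Matrix.trace_mul_comm, Matrix.mul_assoc]
  have hd : (B * S * Bᴴ).det = S.det * E.det := by
    rw [hB]; simp only [Matrix.det_mul]; ring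
  rw [ht, logdet, hd, logdet_mul' S E hS hE] at h
  linarith
end

section
/- Let H be an m×n complex matrix and let Q and Q̃ be n×n Hermitian positive semidefinite complex matrices. Set S := Hᴴ·(I_m + H·Q̃·Hᴴ)⁻¹·H. Then logdet(I_m + H·Q·Hᴴ) ≤ logdet(I_m + H·Q̃·Hᴴ) + Re(trace(S·(Q − Q̃))), where logdet X := Real.log ((Matrix.det X).re) and Hᴴ is the conjugate transpose. -/
open Matrix ComplexOrder

theorem posDef_log_det_le {m : ℕ} (M : Matrix (Fin m) (Fin m) ℂ) (hM : M.PosDef) :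
    Real.log M.det.re ≤ M.trace.re - m := by
  have h1 : M.det.re = ∏ i, hM.1.eigenvalues i := by
    rw [hM.1.det_eq_prod_eigenvalues]
    exact_mod_cast Complex.ofReal_re _
  have h2 : M.trace.re = ∑ i, hM.1.eigenvalues i := by
    rw [hM.1.trace_eq_sum_eigenvalues]
    exact_mod_cast Complex.ofReal_re _
  rw [h1, h2, Real.log_prod (fun i _ => (hM.eigenvalues_pos i).ne')]
  calc _ ≤ ∑ i, (hM.1.eigenvalues i - 1) :=
        Finset.sum_le_sum fun i _ => Real.log_le_sub_one_of_pos (hM.eigenvalues_pos i)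
    _ = _ := by simp [Finset.sum_sub_distrib]

theorem posDef_logdet_tangent {m : ℕ} (A B : Matrix (Fin m) (Fin m) ℂ)
    (hA : A.PosDef) (hB : B.PosDef) :
    Real.log A.det.re ≤ Real.log B.det.re + (B⁻¹ * (A - B)).trace.re := by
  obtain ⟨C, hC⟩ : ∃ C : Matrix (Fin m) (Fin m) ℂ, B⁻¹ = Cᴴ * C := by
    open scoped MatrixOrder in
    exact CStarAlgebra.nonneg_iff_eq_star_mul_self.mp hB.inv.posSemidef.nonneg
  have hu : IsUnit B.det := (Matrix.isUnit_iff_isUnit_det B).mp hB.isUnit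
  have hCu : IsUnit C := by
    have h := hB.inv.isUnit
    rw [hC, Matrix.isUnit_iff_isUnit_det, det_mul] at h
    exact (Matrix.isUnit_iff_isUnit_det C).mpr (isUnit_of_mul_isUnit_right h)
  have hM : (C * A * Cᴴ).PosDef := by
    apply hA.mul_mul_conjTranspose_same
    exact Matrix.vecMul_injective_of_isUnit hCu
  have key := posDef_log_det_le _ hM
  have hdet : (C * A * Cᴴ).det * B.det = A.det := by
    have : B⁻¹.det * B.det = 1 := by
      rw [← det_mul, Matrix.nonsing_inv_mul _ hu, det_one]
    rw [hC, det_mul] at this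
    rw [det_mul, det_mul]
    linear_combination A.det * this
  have htr : (C * A * Cᴴ).trace = (B⁻¹ * A).trace := by
    rw [Matrix.trace_mul_comm, ← Matrix.mul_assoc, hC]
  have hMd := Complex.lt_def.mp hM.det_pos
  have hBd := Complex.lt_def.mp hB.det_pos
  have hre : A.det.re = (C * A * Cᴴ).det.re * B.det.re := by
    rw [← hdet, Complex.mul_re, ← hBd.2]; simp
  rw [hre, Real.log_mul hMd.1.ne' hBd.1.ne', Matrix.mul_sub, Matrix.nonsing_inv_mul _ hu,
    trace_sub, ← htr, trace_one]
  simp only [Complex.sub_re, Fintype.card_fin, Complex.natCast_re]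
  linarith

/-- First-order (tangent-plane) upper bound on the concave log-determinant (ineq. (20)):
with `S = Hᴴ (I + H Q̃ Hᴴ)⁻¹ H`,
`logdet(I + H Q Hᴴ) ≤ logdet(I + H Q̃ Hᴴ) + Re(tr(S (Q - Q̃)))`. -/
theorem stmt3 {m n : ℕ} (H : Matrix (Fin m) (Fin n) ℂ)
    (Q Qt : Matrix (Fin n) (Fin n) ℂ) (hQ : Q.PosSemidef) (hQt : Qt.PosSemidef) :
    logdet (1 + H * Q * Hᴴ) ≤
      logdet (1 + H * Qt * Hᴴ) +
        (Matrix.trace (Hᴴ * (1 + H * Qt * Hᴴ)⁻¹ * H * (Q - Qt))).re := by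
  have h := posDef_logdet_tangent (1 + H * Q * Hᴴ) (1 + H * Qt * Hᴴ)
    (Matrix.PosDef.one.add_posSemidef (hQ.mul_mul_conjTranspose_same H))
    (Matrix.PosDef.one.add_posSemidef (hQt.mul_mul_conjTranspose_same H))
  have e : Matrix.trace (Hᴴ * (1 + H * Qt * Hᴴ)⁻¹ * H * (Q - Qt)) =
      ((1 + H * Qt * Hᴴ)⁻¹ * ((1 + H * Q * Hᴴ) - (1 + H * Qt * Hᴴ))).trace := by
    rw [add_sub_add_left_eq_sub, ← Matrix.sub_mul, ← Matrix.mul_sub, Matrix.mul_assoc,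
      Matrix.mul_assoc, Matrix.trace_mul_comm]
    simp only [Matrix.mul_assoc]
  rw [e]
  exact h
end

section
/- Let H be an m×n complex matrix and let Qc, Qa, E be n×n Hermitian positive semidefinite complex matrices. Then logdet(I_m + (I_m + H·(Qa+E)·Hᴴ)⁻¹·(H·Qc·Hᴴ)) ≤ logdet(I_m + (I_m + H·Qa·Hᴴ)⁻¹·(H·Qc·Hᴴ)), where logdet X := Real.log ((Matrix.det X).re) and Hᴴ is the conjugate transpose. -/
open Matrix ComplexOrder

open scoped MatrixOrder in
theorem psd_factor {N : Type*} [Fintype N] [DecidableEq N] {A : Matrix N N ℂ}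
    (hA : A.PosSemidef) : ∃ B : Matrix N N ℂ, A = B * Bᴴ := by
  obtain ⟨B, hB⟩ := CStarAlgebra.nonneg_iff_eq_mul_star_self.mp hA.nonneg
  exact ⟨B, hB⟩

theorem one_le_det_one_add {N : Type*} [Fintype N] [DecidableEq N] {A : Matrix N N ℂ}
    (hA : A.PosSemidef) : 1 ≤ (1 + A).det := by
  have h1 : (1 + A).det = ∏ i, ((1 + hA.isHermitian.eigenvalues i : ℝ) : ℂ) := by
    have h := hA.isHermitian.spectral_theorem
    rw [Unitary.conjStarAlgAut_apply] at h
    conv_lhs => rw [h, mul_assoc, det_one_add_mul_comm, mul_assoc]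
    rw [Unitary.coe_star_mul_self, mul_one, ← diagonal_one, diagonal_add, det_diagonal]
    simp
  rw [h1, ← Complex.ofReal_prod, ← Complex.ofReal_one, Complex.real_le_real]
  refine Finset.prod_induction _ (fun x : ℝ => 1 ≤ x) (fun a b ha hb => one_le_mul_of_one_le_of_one_le ha hb)
    le_rfl fun i _ => by
    have := hA.eigenvalues_nonneg i
    linarith

theorem det_le_det_add {N : Type*} [Fintype N] [DecidableEq N] {P R : Matrix N N ℂ}
    (hP : P.PosDef) (hR : R.PosSemidef) : P.det ≤ (P + R).det := by
  obtain ⟨T, rfl⟩ := psd_factor hR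
  have hu : IsUnit P.det := (Matrix.isUnit_iff_isUnit_det _).mp hP.isUnit
  have h1 : P + T * Tᴴ = P * (1 + P⁻¹ * T * Tᴴ) := by
    rw [mul_add, mul_one, mul_assoc P⁻¹, mul_nonsing_inv_cancel_left _ _ hu]
  rw [h1, det_mul, det_one_add_mul_comm]
  have h2 := one_le_det_one_add (hP.inv.posSemidef.conjTranspose_mul_mul_same T)
  rw [mul_assoc] at h2
  exact le_mul_of_one_le_right hP.det_pos.le h2

theorem inv_sub_inv_psd {N : Type*} [Fintype N] [DecidableEq N] {B D : Matrix N N ℂ}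
    (hB : B.PosDef) (hD : D.PosSemidef) : (B⁻¹ - (B + D)⁻¹).PosSemidef := by
  have hBD : (B + D).PosDef := hB.add_posSemidef hD
  have hBi := hB.inv
  letI := hB.isUnit.invertible
  letI := hBD.isUnit.invertible
  letI := hBi.isUnit.invertible
  have h1 := hBD.fromBlocks₁₁ (1 : Matrix N N ℂ) B⁻¹
  have h2 := PosDef.fromBlocks₂₂ (B + D) (1 : Matrix N N ℂ) hBi
  have h3 := h1.symm.trans h2
  simp only [conjTranspose_one, one_mul, mul_one, inv_inv_of_invertible, add_sub_cancel_left] at h3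
  exact h3.mpr hD

/-- Inequality (CF3): adding extra PSD artificial noise `E` to the noise covariance `Qa`
cannot increase the eavesdropper's rate. -/
theorem stmt6 {m n : ℕ} (H : Matrix (Fin m) (Fin n) ℂ)
    (Qc Qa E : Matrix (Fin n) (Fin n) ℂ)
    (hQc : Qc.PosSemidef) (hQa : Qa.PosSemidef) (hE : E.PosSemidef) :
    logdet (1 + (1 + H * (Qa + E) * Hᴴ)⁻¹ * (H * Qc * Hᴴ)) ≤
      logdet (1 + (1 + H * Qa * Hᴴ)⁻¹ * (H * Qc * Hᴴ)) := by
  set B := 1 + H * Qa * Hᴴ with hBdef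
  have hB : B.PosDef := PosDef.one.add_posSemidef (hQa.mul_mul_conjTranspose_same H)
  have hD := hE.mul_mul_conjTranspose_same H
  have e1 : 1 + H * (Qa + E) * Hᴴ = B + H * E * Hᴴ := by
    rw [hBdef, Matrix.mul_add, Matrix.add_mul, add_assoc]
  rw [e1]
  obtain ⟨C, hC⟩ := psd_factor (hQc.mul_mul_conjTranspose_same H)
  rw [hC]
  have hBD := hB.add_posSemidef hD
  have hP : (1 + Cᴴ * (B + H * E * Hᴴ)⁻¹ * C).PosDef :=
    PosDef.one.add_posSemidef (hBD.inv.posSemidef.conjTranspose_mul_mul_same C)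
  have key := det_le_det_add hP ((inv_sub_inv_psd hB hD).conjTranspose_mul_mul_same C)
  have e2 : 1 + Cᴴ * (B + H * E * Hᴴ)⁻¹ * C + Cᴴ * (B⁻¹ - (B + H * E * Hᴴ)⁻¹) * C
      = 1 + Cᴴ * B⁻¹ * C := by noncomm_ring
  have e3 : ∀ X : Matrix (Fin m) (Fin m) ℂ,
      (1 + X * (C * Cᴴ)).det = (1 + Cᴴ * X * C).det := by
    intro X
    rw [← mul_assoc, det_one_add_mul_comm, ← mul_assoc]
  rw [e2] at key
  unfold logdet
  rw [e3, e3]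
  exact Real.log_le_log (Complex.pos_iff.mp hP.det_pos).1 (Complex.le_def.mp key).1
end

section
/- Let H be an m×n complex matrix, let Q0, M, E be n×n Hermitian positive semidefinite complex matrices, and let ξ ∈ [0,1] be real. Then logdet(I_m + (I_m + H·(M+E)·Hᴴ)⁻¹·(ξ•(H·Q0·Hᴴ))) ≤ logdet(I_m + (I_m + H·M·Hᴴ)⁻¹·(H·Q0·Hᴴ)), where logdet X := Real.log ((Matrix.det X).re) and Hᴴ is the conjugate transpose. -/
open Matrix ComplexOrder

open scoped MatrixOrder Matrix.Norms.L2Operator in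
lemma psd_factor_s7 {m : ℕ} {P : Matrix (Fin m) (Fin m) ℂ} (hP : P.PosSemidef) :
    ∃ K : Matrix (Fin m) (Fin m) ℂ, P = Kᴴ * K :=
  CStarAlgebra.nonneg_iff_eq_star_mul_self.mp hP.nonneg

lemma one_le_det_one_add_s7 {m : ℕ} {P : Matrix (Fin m) (Fin m) ℂ} (hP : P.PosSemidef) :
    1 ≤ (1 + P).det := by
  have h : (1 + P).det = ∏ i, (1 + (hP.1.eigenvalues i : ℂ)) := by
    have h1 : 1 + P = Unitary.conjStarAlgAut ℂ _ hP.1.eigenvectorUnitary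
        (1 + diagonal (RCLike.ofReal ∘ hP.1.eigenvalues)) := by
      rw [map_add, map_one, ← hP.1.spectral_theorem]
    rw [h1, Unitary.conjStarAlgAut_apply, det_mul_right_comm, Unitary.mul_star_self_of_mem (SetLike.coe_mem _), one_mul,
      ← diagonal_one, diagonal_add, det_diagonal]
    simp
  rw [h]
  have h2 : (1 : ℝ) ≤ ∏ i, (1 + hP.1.eigenvalues i) :=
    Finset.prod_induction _ (fun x : ℝ => 1 ≤ x) (fun a b ha hb => one_le_mul_of_one_le_of_one_le ha hb) le_rfl
      (fun i _ => by linarith [hP.eigenvalues_nonneg i])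
  exact_mod_cast h2

lemma det_mono {m : ℕ} {A P : Matrix (Fin m) (Fin m) ℂ} (hA : A.PosDef) (hP : P.PosSemidef) :
    A.det ≤ (A + P).det := by
  obtain ⟨K, rfl⟩ := psd_factor_s7 hP
  rw [det_add_mul _ _ ((isUnit_iff_isUnit_det _).1 hA.isUnit)]
  exact le_mul_of_one_le_right hA.det_pos.le
    (one_le_det_one_add_s7 (hA.inv.posSemidef.mul_mul_conjTranspose_same K))

lemma inv_sub_inv_psd_s7 {m : ℕ} {A P : Matrix (Fin m) (Fin m) ℂ} (hA : A.PosDef)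
    (hP : P.PosSemidef) : (A⁻¹ - (A + P)⁻¹).PosSemidef := by
  have hB := hA.add_posSemidef hP
  have uA := (isUnit_iff_isUnit_det _).1 hA.isUnit
  have uB := (isUnit_iff_isUnit_det _).1 hB.isUnit
  generalize hBe : A + P = B at *
  have hPe : P = B - A := by rw [← hBe]; abel
  have hBi : (B⁻¹)ᴴ = B⁻¹ := hB.inv.1
  have key : A⁻¹ - B⁻¹ = B⁻¹ * P * (B⁻¹)ᴴ + B⁻¹ * (P * A⁻¹ * Pᴴ) * (B⁻¹)ᴴ := by
    rw [hBi, hP.1.eq, hPe]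
    have a1 := mul_nonsing_inv A uA
    have a2 := nonsing_inv_mul A uA
    have b1 := mul_nonsing_inv B uB
    have b2 := nonsing_inv_mul B uB
    have e1 : B⁻¹ * (B - A) = 1 - B⁻¹ * A := by rw [mul_sub, b2]
    have e2 : (B - A) * B⁻¹ = 1 - A * B⁻¹ := by rw [sub_mul, b1]
    have e3 : B⁻¹ * ((B - A) * A⁻¹ * (B - A)) * B⁻¹
        = (B⁻¹ * (B - A)) * A⁻¹ * ((B - A) * B⁻¹) := by simp only [Matrix.mul_assoc]
    have e4 : (1 - B⁻¹ * A) * A⁻¹ = A⁻¹ - B⁻¹ := by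
      rw [sub_mul, one_mul, Matrix.mul_assoc, a1, mul_one]
    have e5 : A⁻¹ * (A * B⁻¹) = B⁻¹ := by rw [← Matrix.mul_assoc, a2, one_mul]
    rw [e3, e1, e2, e4, mul_sub, mul_one, sub_mul A⁻¹, e5, sub_mul, one_mul, Matrix.mul_assoc]
    abel
  rw [key]
  exact (hP.mul_mul_conjTranspose_same _).add
    ((hA.inv.posSemidef.mul_mul_conjTranspose_same P).mul_mul_conjTranspose_same _)

/-- Inequality (CF2): scaling down the multicast covariance `Q0` by `ξ ≤ 1` and adding
extra PSD interference `E` to the effective noise covariance `M` cannot increase the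
multicast rate. -/
theorem stmt7 {m n : ℕ} (H : Matrix (Fin m) (Fin n) ℂ)
    (Q0 M E : Matrix (Fin n) (Fin n) ℂ)
    (hQ0 : Q0.PosSemidef) (hM : M.PosSemidef) (hE : E.PosSemidef)
    (ξ : ℝ) (hξ : ξ ∈ Set.Icc (0 : ℝ) 1) :
    logdet (1 + (1 + H * (M + E) * Hᴴ)⁻¹ * (ξ • (H * Q0 * Hᴴ))) ≤
      logdet (1 + (1 + H * M * Hᴴ)⁻¹ * (H * Q0 * Hᴴ)) := by
  have hA : (1 + H * M * Hᴴ).PosDef :=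
    PosDef.one.add_posSemidef (hM.mul_mul_conjTranspose_same H)
  have hP := hE.mul_mul_conjTranspose_same H
  have hBe : 1 + H * (M + E) * Hᴴ = (1 + H * M * Hᴴ) + H * E * Hᴴ := by
    rw [Matrix.mul_add, Matrix.add_mul, add_assoc]
  rw [hBe]
  obtain ⟨G, hG⟩ := psd_factor_s7 (hQ0.mul_mul_conjTranspose_same H)
  rw [hG]
  generalize 1 + H * M * Hᴴ = A at *
  generalize H * E * Hᴴ = P at *
  have hB := hA.add_posSemidef hP
  have h1 : (1 + (A + P)⁻¹ * (ξ • (Gᴴ * G))).det = (1 + ξ • (G * (A + P)⁻¹ * Gᴴ)).det := by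
    rw [← Matrix.smul_mul, ← Matrix.mul_assoc, det_one_add_mul_comm, Matrix.mul_smul,
      Matrix.mul_smul, ← Matrix.mul_assoc]
  have h2 : (1 + A⁻¹ * (Gᴴ * G)).det = (1 + G * A⁻¹ * Gᴴ).det := by
    rw [← Matrix.mul_assoc, det_one_add_mul_comm, ← Matrix.mul_assoc]
  have hN := hB.inv.posSemidef.mul_mul_conjTranspose_same G
  have hX : (1 + ξ • (G * (A + P)⁻¹ * Gᴴ)).PosDef :=
    PosDef.one.add_posSemidef (hN.smul hξ.1)
  have hD := ((inv_sub_inv_psd_s7 hA hP).mul_mul_conjTranspose_same G).add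
    (hN.smul (sub_nonneg.2 hξ.2))
  have hle := det_mono hX hD
  have he : 1 + ξ • (G * (A + P)⁻¹ * Gᴴ) + (G * (A⁻¹ - (A + P)⁻¹) * Gᴴ
      + (1 - ξ) • (G * (A + P)⁻¹ * Gᴴ)) = 1 + G * A⁻¹ * Gᴴ := by
    rw [Matrix.mul_sub, Matrix.sub_mul, sub_smul, one_smul]
    abel
  rw [he] at hle
  unfold logdet
  rw [h1, h2]
  exact Real.log_le_log (Complex.pos_iff.1 hX.det_pos).1 (Complex.le_def.1 hle).1
end

section
/- Let H be an m×n complex matrix and let N, Q, E be n×n Hermitian positive semidefinite complex matrices. Then logdet(I_m + (I_m + H·N·Hᴴ)⁻¹·(H·(Q+E)·Hᴴ)) ≥ logdet(I_m + (I_m + H·N·Hᴴ)⁻¹·(H·Q·Hᴴ)), where logdet X := Real.log ((Matrix.det X).re) and Hᴴ is the conjugate transpose. -/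
open Matrix ComplexOrder

lemma aux_one_le_s8 {k : ℕ} (P : Matrix (Fin k) (Fin k) ℂ) (hP : P.PosSemidef) :
    1 ≤ (1 + P).det := by
  have h : (1 + P).det = ∏ i, (1 + (hP.isHermitian.eigenvalues i : ℂ)) := by
    have h1 := congrArg (Polynomial.eval (-1 : ℂ)) hP.isHermitian.charpoly_eq
    rw [Matrix.eval_charpoly, Polynomial.eval_prod] at h1
    have h2 : (1 + P) = -(Matrix.scalar (Fin k) (-1 : ℂ) - P) := by
      rw [map_neg, map_one]; abel
    rw [h2, Matrix.det_neg, h1, Fintype.card, ← Finset.prod_const, ← Finset.prod_mul_distrib]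
    refine Finset.prod_congr rfl fun i _ => ?_
    simp
    ring
  rw [h]
  have h3 : (1 : ℝ) ≤ ∏ i, (1 + hP.isHermitian.eigenvalues i) :=
    Finset.prod_induction _ (fun x : ℝ => 1 ≤ x) (fun _ _ => one_le_mul_of_one_le_of_one_le) le_rfl
      fun i _ => by linarith [hP.eigenvalues_nonneg i]
  exact_mod_cast h3

open scoped MatrixOrder Matrix.Norms.L2Operator in
lemma aux_fac {k : ℕ} (P : Matrix (Fin k) (Fin k) ℂ) (hP : P.PosSemidef) :
    ∃ B : Matrix (Fin k) (Fin k) ℂ, P = Bᴴ * B :=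
  CStarAlgebra.nonneg_iff_eq_star_mul_self.mp hP.nonneg

lemma aux_mono_s8 {k : ℕ} (A P : Matrix (Fin k) (Fin k) ℂ) (hA : A.PosDef) (hP : P.PosSemidef) :
    A.det ≤ (A + P).det := by
  obtain ⟨B, rfl⟩ := aux_fac P hP
  have hu : IsUnit A.det := (Matrix.isUnit_iff_isUnit_det _).1 hA.isUnit
  have h : A + Bᴴ * B = A * (1 + A⁻¹ * Bᴴ * B) := by
    rw [mul_add, mul_one, Matrix.mul_assoc A⁻¹, Matrix.mul_nonsing_inv_cancel_left _ _ hu]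
  rw [h, Matrix.det_mul, Matrix.det_one_add_mul_comm, ← Matrix.mul_assoc]
  exact le_mul_of_one_le_right hA.det_pos.le
    (aux_one_le_s8 _ (hA.inv.posSemidef.mul_mul_conjTranspose_same B))

/-- Monotonicity of the capacity function in the signal covariance: adding a PSD matrix
`E` to the signal covariance `Q` does not decrease the rate. -/
theorem stmt8 {m n : ℕ} (H : Matrix (Fin m) (Fin n) ℂ)
    (N Q E : Matrix (Fin n) (Fin n) ℂ)
    (hN : N.PosSemidef) (hQ : Q.PosSemidef) (hE : E.PosSemidef) :
    logdet (1 + (1 + H * N * Hᴴ)⁻¹ * (H * Q * Hᴴ)) ≤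
      logdet (1 + (1 + H * N * Hᴴ)⁻¹ * (H * (Q + E) * Hᴴ)) := by
  have hS : (1 + H * N * Hᴴ).PosDef :=
    Matrix.PosDef.one.add_posSemidef (hN.mul_mul_conjTranspose_same H)
  rw [Matrix.mul_add H, Matrix.add_mul _ _ Hᴴ]
  have hX := hQ.mul_mul_conjTranspose_same H
  have hY := hE.mul_mul_conjTranspose_same H
  generalize 1 + H * N * Hᴴ = S at *
  generalize H * Q * Hᴴ = X at *
  generalize H * E * Hᴴ = Y at *
  have hu : IsUnit S.det := (Matrix.isUnit_iff_isUnit_det _).1 hS.isUnit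
  have key : ∀ Z, (1 + S⁻¹ * Z).det = S⁻¹.det * (S + Z).det := fun Z => by
    rw [← Matrix.det_mul, mul_add, Matrix.nonsing_inv_mul _ hu]
  have hSX := hS.add_posSemidef hX
  have hle : (1 + S⁻¹ * X).det ≤ (1 + S⁻¹ * (X + Y)).det := by
    rw [key, key, ← add_assoc]
    exact mul_le_mul_of_nonneg_left (aux_mono_s8 _ _ hSX hY) hS.inv.det_pos.le
  have hpos : 0 < (1 + S⁻¹ * X).det := by
    rw [key]
    exact mul_pos hS.inv.det_pos hSX.det_pos
  exact Real.log_le_log (Complex.pos_iff.1 hpos).1 (Complex.le_def.1 hle).1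
end

section
/- Let K ≥ 1 and let H_k be an m_k × n complex matrix for each k ∈ {1,…,K}. Let Q0 and N be n×n Hermitian positive semidefinite complex matrices, and for ν ∈ ℝ define C_k(ν) := logdet(I + (I + H_k·N·H_kᴴ)⁻¹·(ν•(H_k·Q0·H_kᴴ))), where logdet X := Real.log ((Matrix.det X).re). If τ is a real number with 0 ≤ τ ≤ min_{1≤k≤K} C_k(1), then there exists ν ∈ [0,1] such that min_{1≤k≤K} C_k(ν) = τ. -/
open Matrix ComplexOrder

theorem aux_pos {n m : ℕ} (H : Matrix (Fin m) (Fin n) ℂ)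
    (Q0 N : Matrix (Fin n) (Fin n) ℂ) (hQ0 : Q0.PosSemidef) (hN : N.PosSemidef)
    (ν : ℝ) (hν : 0 ≤ ν) :
    0 < (1 + (1 + H * N * Hᴴ)⁻¹ * (ν • (H * Q0 * Hᴴ))).det.re := by
  have hA : (1 + H * N * Hᴴ).PosDef :=
    Matrix.PosDef.one.add_posSemidef (hN.mul_mul_conjTranspose_same H)
  have hB : (ν • (H * Q0 * Hᴴ)).PosSemidef :=
    (hQ0.mul_mul_conjTranspose_same H).smul hν
  have hC := hA.add_posSemidef hB
  have hu : IsUnit (1 + H * N * Hᴴ).det := hA.det_pos.ne'.isUnit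
  have e : 1 + (1 + H * N * Hᴴ)⁻¹ * (ν • (H * Q0 * Hᴴ))
      = (1 + H * N * Hᴴ)⁻¹ * ((1 + H * N * Hᴴ) + ν • (H * Q0 * Hᴴ)) := by
    rw [Matrix.mul_add, Matrix.nonsing_inv_mul _ hu]
  rw [e, Matrix.det_mul]
  have := mul_pos hA.inv.det_pos hC.det_pos
  exact (Complex.lt_def.1 this).1

/-- The bisection / intermediate-value claim underlying Lemma 1 and Corollary 1:
the minimum multicast rate `min_k C_k(ν)` can be brought exactly to any target
`τ ∈ [0, min_k C_k(1)]` by scaling the multicast covariance `Q0` by some `ν ∈ [0,1]`. -/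
theorem stmt9 {n K : ℕ} (hK : 1 ≤ K) {m : Fin K → ℕ}
    (H : (k : Fin K) → Matrix (Fin (m k)) (Fin n) ℂ)
    (Q0 N : Matrix (Fin n) (Fin n) ℂ) (hQ0 : Q0.PosSemidef) (hN : N.PosSemidef)
    (τ : ℝ) (hτ0 : 0 ≤ τ)
    (hτ : τ ≤ Finset.univ.inf' ⟨⟨0, hK⟩, Finset.mem_univ _⟩ fun k =>
        logdet (1 + (1 + H k * N * (H k)ᴴ)⁻¹ * ((1 : ℝ) • (H k * Q0 * (H k)ᴴ)))) :
    ∃ ν ∈ Set.Icc (0 : ℝ) 1,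
      (Finset.univ.inf' ⟨⟨0, hK⟩, Finset.mem_univ _⟩ fun k =>
        logdet (1 + (1 + H k * N * (H k)ᴴ)⁻¹ * (ν • (H k * Q0 * (H k)ᴴ)))) = τ := by
  have hpos : ∀ k, ∀ ν ∈ Set.Icc (0 : ℝ) 1,
      0 < (1 + (1 + H k * N * (H k)ᴴ)⁻¹ * (ν • (H k * Q0 * (H k)ᴴ))).det.re :=
    fun k ν hν => aux_pos (H k) Q0 N hQ0 hN ν hν.1
  have hcont : ContinuousOn (fun ν : ℝ =>
      Finset.univ.inf' ⟨⟨0, hK⟩, Finset.mem_univ _⟩ fun k : Fin K =>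
        logdet (1 + (1 + H k * N * (H k)ᴴ)⁻¹ * (ν • (H k * Q0 * (H k)ᴴ)))) (Set.Icc 0 1) := by
    apply ContinuousOn.finset_inf'_apply
    intro k _
    unfold logdet
    apply ContinuousOn.log
    · apply Continuous.continuousOn
      apply Complex.continuous_re.comp
      apply Continuous.matrix_det
      fun_prop
    · intro ν hν
      exact (hpos k ν hν).ne'
  have h := intermediate_value_Icc (zero_le_one' ℝ) hcont
  have h0 : (Finset.univ.inf' ⟨⟨0, hK⟩, Finset.mem_univ _⟩ fun k : Fin K =>
        logdet (1 + (1 + H k * N * (H k)ᴴ)⁻¹ * ((0 : ℝ) • (H k * Q0 * (H k)ᴴ)))) = 0 := by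
    simp only [logdet, zero_smul, Matrix.mul_zero, add_zero, Matrix.det_one, Complex.one_re, Real.log_one]
    exact Finset.inf'_const _ _
  obtain ⟨ν, hν, he⟩ := h (show τ ∈ _ from ⟨h0.le.trans hτ0, hτ⟩)
  exact ⟨ν, hν, he⟩
end

section
/- Let K ≥ 2, let H_k be an m_k × n complex matrix for k ∈ {1,…,K}, let P > 0 and τ ≥ 0 be reals. Suppose (Q0,Qc,Qa) is a triple of n×n Hermitian positive semidefinite complex matrices with Re(trace(Q0+Qc+Qa)) ≤ P and min_{1≤k≤K} C_{m,k}(Q0,Qc,Qa) ≥ τ. Then there exists ν ∈ [0,1] such that the triple (ν•Q0, Qc, Qa) consists of Hermitian PSD matrices, satisfies Re(trace(ν•Q0+Qc+Qa)) ≤ P and min_{1≤k≤K} C_{m,k}(ν•Q0,Qc,Qa) = τ, and has the same secrecy objective: f_s(Qc,Qa) is unchanged (it does not depend on Q0). Hence the relaxed problem (with multicast constraint ≥ τ) and the equality-constrained problem (with multicast constraint = τ) have the same optimal value. -/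
open Matrix ComplexOrder

/-- Multicast rate of the receiver with channel `H`:
`C_m = logdet(I + (I + H (Qc+Qa) Hᴴ)⁻¹ (H Q0 Hᴴ))`. -/
noncomputable def Cmk {p n : ℕ} (H : Matrix (Fin p) (Fin n) ℂ)
    (Q0 Qc Qa : Matrix (Fin n) (Fin n) ℂ) : ℝ :=
  logdet (1 + (1 + H * (Qc + Qa) * Hᴴ)⁻¹ * (H * Q0 * Hᴴ))

/-- Rate of the confidential message at the receiver with channel `H`
(legitimate-link rate `C_b` when `H = H_1`, eavesdropping rate `C_{e,k}` otherwise):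
`logdet(I + (I + H Qa Hᴴ)⁻¹ (H Qc Hᴴ))`. -/
noncomputable def Cek {p n : ℕ} (H : Matrix (Fin p) (Fin n) ℂ)
    (Qc Qa : Matrix (Fin n) (Fin n) ℂ) : ℝ :=
  logdet (1 + (1 + H * Qa * Hᴴ)⁻¹ * (H * Qc * Hᴴ))

/-- The secrecy objective `f_s(Qc,Qa) = C_b(Qc,Qa) - max_{2 ≤ k ≤ K} C_{e,k}(Qc,Qa)`,
where receiver `1` is the index `0` of `Fin K`. -/
noncomputable def fsObj {n K : ℕ} (hK : 2 ≤ K) {p : Fin K → ℕ}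
    (H : (k : Fin K) → Matrix (Fin (p k)) (Fin n) ℂ)
    (Qc Qa : Matrix (Fin n) (Fin n) ℂ) : ℝ :=
  Cek (H ⟨0, by omega⟩) Qc Qa -
    (Finset.univ.erase (⟨0, by omega⟩ : Fin K)).sup'
      ⟨⟨1, hK⟩, by simp [Finset.mem_erase, Fin.ext_iff]⟩
      (fun k => Cek (H k) Qc Qa)

theorem aux_det_pos {p n : ℕ} (H : Matrix (Fin p) (Fin n) ℂ)
    (Q0 Qc Qa : Matrix (Fin n) (Fin n) ℂ)
    (hQ0 : Q0.PosSemidef) (hQc : Qc.PosSemidef) (hQa : Qa.PosSemidef) :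
    0 < (1 + (1 + H * (Qc + Qa) * Hᴴ)⁻¹ * (H * Q0 * Hᴴ)).det.re := by
  have hA : (1 + H * (Qc + Qa) * Hᴴ).PosDef :=
    Matrix.PosDef.one.add_posSemidef ((hQc.add hQa).mul_mul_conjTranspose_same H)
  have hB : (H * Q0 * Hᴴ).PosSemidef := hQ0.mul_mul_conjTranspose_same H
  have hAB := hA.add_posSemidef hB
  generalize (1 + H * (Qc + Qa) * Hᴴ) = A at *
  generalize H * Q0 * Hᴴ = B at *
  have hu : IsUnit A.det := (Matrix.isUnit_iff_isUnit_det A).1 hA.isUnit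
  have h1 : 1 + A⁻¹ * B = A⁻¹ * (A + B) := by
    rw [mul_add, Matrix.nonsing_inv_mul A hu]
  rw [h1, Matrix.det_mul]
  have h2 : 0 < A⁻¹.det * (A + B).det := mul_pos hA.inv.det_pos hAB.det_pos
  exact (Complex.lt_def.1 h2).1

theorem aux_cont {p n : ℕ} (H : Matrix (Fin p) (Fin n) ℂ)
    (Q0 Qc Qa : Matrix (Fin n) (Fin n) ℂ)
    (hQ0 : Q0.PosSemidef) (hQc : Qc.PosSemidef) (hQa : Qa.PosSemidef) :
    ContinuousOn (fun ν : ℝ => Cmk H (ν • Q0) Qc Qa) (Set.Icc 0 1) := by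
  unfold Cmk logdet
  apply ContinuousOn.log
  · apply Continuous.continuousOn
    apply Complex.continuous_re.comp
    apply Continuous.matrix_det
    fun_prop
  · intro ν hν
    exact (aux_det_pos H (ν • Q0) Qc Qa (hQ0.smul hν.1) hQc hQa).ne'

/-- Lemma 1 (tightness of the relaxation): any feasible point of the relaxed problem,
whose minimum multicast rate is at least `τ`, can be converted by scaling `Q0` by some
`ν ∈ [0,1]` into a feasible point whose minimum multicast rate is exactly `τ`, keeping
the power constraint and leaving the secrecy objective `f_s` (which does not depend on
`Q0`) unchanged. -/
theorem stmt10 {n K : ℕ} (hK : 2 ≤ K) {p : Fin K → ℕ}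
    (H : (k : Fin K) → Matrix (Fin (p k)) (Fin n) ℂ)
    (P τ : ℝ) (hP : 0 < P) (hτ0 : 0 ≤ τ)
    (Q0 Qc Qa : Matrix (Fin n) (Fin n) ℂ)
    (hQ0 : Q0.PosSemidef) (hQc : Qc.PosSemidef) (hQa : Qa.PosSemidef)
    (hpow : (Matrix.trace (Q0 + Qc + Qa)).re ≤ P)
    (hmin : τ ≤ Finset.univ.inf' ⟨⟨0, by omega⟩, Finset.mem_univ _⟩
        fun k => Cmk (H k) Q0 Qc Qa) :
    ∃ ν ∈ Set.Icc (0 : ℝ) 1,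
      (ν • Q0).PosSemidef ∧ Qc.PosSemidef ∧ Qa.PosSemidef ∧
      (Matrix.trace (ν • Q0 + Qc + Qa)).re ≤ P ∧
      (Finset.univ.inf' ⟨⟨0, by omega⟩, Finset.mem_univ _⟩
        fun k => Cmk (H k) (ν • Q0) Qc Qa) = τ ∧
      fsObj hK H Qc Qa = fsObj hK H Qc Qa := by
  have hne : (Finset.univ : Finset (Fin K)).Nonempty := ⟨⟨0, by omega⟩, Finset.mem_univ _⟩
  have hc : ContinuousOn (fun ν : ℝ => Finset.univ.inf' hne
      fun k => Cmk (H k) (ν • Q0) Qc Qa) (Set.Icc 0 1) :=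
    ContinuousOn.finset_inf'_apply hne fun k _ => aux_cont (H k) Q0 Qc Qa hQ0 hQc hQa
  have h0 : (Finset.univ.inf' hne fun k => Cmk (H k) ((0 : ℝ) • Q0) Qc Qa) = 0 := by
    simp [Cmk, logdet]
  have hmem : τ ∈ Set.Icc
      (Finset.univ.inf' hne fun k => Cmk (H k) ((0 : ℝ) • Q0) Qc Qa)
      (Finset.univ.inf' hne fun k => Cmk (H k) ((1 : ℝ) • Q0) Qc Qa) := by
    rw [h0]
    simp only [one_smul]
    exact ⟨hτ0, hmin⟩
  obtain ⟨ν, hν, hντ⟩ := intermediate_value_Icc zero_le_one hc hmem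
  refine ⟨ν, hν, hQ0.smul hν.1, hQc, hQa, ?_, hντ, rfl⟩
  have ht : 0 ≤ (Matrix.trace Q0).re := (Complex.le_def.1 hQ0.trace_nonneg).1
  simp only [Matrix.trace_add, Matrix.trace_smul, Complex.add_re, Complex.real_smul,
    Complex.re_ofReal_mul] at hpow ⊢
  nlinarith [hν.2]
end

section
/- Let K ≥ 2, let H_k be an m_k × n complex matrix for k ∈ {1,…,K}, let P > 0 and τ ≥ 0 be reals. Define the relaxed feasible set F_≥ of triples (Q0,Qc,Qa) of n×n Hermitian PSD matrices with Re(trace(Q0+Qc+Qa)) ≤ P and min_{1≤k≤K} C_{m,k}(Q0,Qc,Qa) ≥ τ, and the equality-constrained set F_= where instead min_{1≤k≤K} C_{m,k}(Q0,Qc,Qa) = τ. Suppose (Q0*,Qc*,Qa*) ∈ F_≥ maximizes the secrecy objective over F_≥, i.e., f_s(Qc*,Qa*) ≥ f_s(Qc,Qa) for every (Q0,Qc,Qa) ∈ F_≥. Then there exists ν ∈ [0,1] such that (ν•Q0*, Qc*, Qa*) ∈ F_= and (ν•Q0*, Qc*, Qa*) maximizes the secrecy objective over F_=, i.e., f_s(Qc*,Qa*)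 ≥ f_s(Qc,Qa) for every (Q0,Qc,Qa) ∈ F_=. -/
open Matrix ComplexOrder

lemma det_pos_aux {q : ℕ} (A B : Matrix (Fin q) (Fin q) ℂ) (hA : A.PosDef)
    (hB : B.PosSemidef) : 0 < (1 + A⁻¹ * B).det.re := by
  have h1 : 0 < A.det := hA.det_pos
  have h2 : 0 < (A + B).det := (hA.add_posSemidef hB).det_pos
  have hu : IsUnit A.det := h1.ne'.isUnit
  have h3 : A + B = A * (1 + A⁻¹ * B) := by
    rw [mul_add, mul_one, Matrix.mul_nonsing_inv_cancel_left _ _ hu]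
  rw [h3, Matrix.det_mul] at h2
  have h4 : 0 < (1 + A⁻¹ * B).det := (pos_iff_pos_of_mul_pos h2).1 h1
  exact (Complex.pos_iff.1 h4).1

lemma Cmk_cont_aux {q n : ℕ} (H : Matrix (Fin q) (Fin n) ℂ)
    (Q0 Qc Qa : Matrix (Fin n) (Fin n) ℂ)
    (hQ0 : Q0.PosSemidef) (hQc : Qc.PosSemidef) (hQa : Qa.PosSemidef) :
    ContinuousOn (fun ν : ℝ => Cmk H (ν • Q0) Qc Qa) (Set.Icc 0 1) := by
  unfold Cmk logdet
  refine ContinuousOn.log ?_ ?_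
  · apply Continuous.continuousOn
    refine Complex.continuous_re.comp (Continuous.matrix_det ?_)
    fun_prop
  · intro ν hν
    refine (det_pos_aux _ _ ?_ ?_).ne'
    · exact Matrix.PosDef.one.add_posSemidef ((hQc.add hQa).mul_mul_conjTranspose_same H)
    · exact (hQ0.smul hν.1).mul_mul_conjTranspose_same H

/-- Corollary 1: an optimal solution `(Q0*,Qc*,Qa*)` of the relaxed problem (multicast
constraint `≥ τ`) can be converted, by scaling `Q0*` by some `ν ∈ [0,1]`, into a point of
the equality-constrained set (multicast constraint `= τ`) that maximizes the secrecy
objective `f_s` over that set. -/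
theorem stmt11 {n K : ℕ} (hK : 2 ≤ K) {p : Fin K → ℕ}
    (H : (k : Fin K) → Matrix (Fin (p k)) (Fin n) ℂ)
    (P τ : ℝ) (hP : 0 < P) (hτ0 : 0 ≤ τ)
    (Q0 Qc Qa : Matrix (Fin n) (Fin n) ℂ)
    (hQ0 : Q0.PosSemidef) (hQc : Qc.PosSemidef) (hQa : Qa.PosSemidef)
    (hpow : (Matrix.trace (Q0 + Qc + Qa)).re ≤ P)
    (hmin : τ ≤ Finset.univ.inf' ⟨⟨0, by omega⟩, Finset.mem_univ _⟩
        fun k => Cmk (H k) Q0 Qc Qa)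
    (hopt : ∀ Q0' Qc' Qa' : Matrix (Fin n) (Fin n) ℂ,
        Q0'.PosSemidef → Qc'.PosSemidef → Qa'.PosSemidef →
        (Matrix.trace (Q0' + Qc' + Qa')).re ≤ P →
        τ ≤ (Finset.univ.inf' ⟨⟨0, by omega⟩, Finset.mem_univ _⟩
          fun k => Cmk (H k) Q0' Qc' Qa') →
        fsObj hK H Qc' Qa' ≤ fsObj hK H Qc Qa) :
    ∃ ν ∈ Set.Icc (0 : ℝ) 1,
      (ν • Q0).PosSemidef ∧
      (Matrix.trace (ν • Q0 + Qc + Qa)).re ≤ P ∧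
      (Finset.univ.inf' ⟨⟨0, by omega⟩, Finset.mem_univ _⟩
        fun k => Cmk (H k) (ν • Q0) Qc Qa) = τ ∧
      ∀ Q0' Qc' Qa' : Matrix (Fin n) (Fin n) ℂ,
        Q0'.PosSemidef → Qc'.PosSemidef → Qa'.PosSemidef →
        (Matrix.trace (Q0' + Qc' + Qa')).re ≤ P →
        (Finset.univ.inf' ⟨⟨0, by omega⟩, Finset.mem_univ _⟩
          fun k => Cmk (H k) Q0' Qc' Qa') = τ →
        fsObj hK H Qc' Qa' ≤ fsObj hK H Qc Qa := by
  have hne : (Finset.univ : Finset (Fin K)).Nonempty := ⟨⟨0, by omega⟩, Finset.mem_univ _⟩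
  have hcont : ContinuousOn (fun ν : ℝ => Finset.univ.inf' hne
      fun k => Cmk (H k) (ν • Q0) Qc Qa) (Set.Icc 0 1) :=
    ContinuousOn.finset_inf'_apply hne
      fun k _ => Cmk_cont_aux (H k) Q0 Qc Qa hQ0 hQc hQa
  have hz : (Finset.univ.inf' hne fun k => Cmk (H k) ((0 : ℝ) • Q0) Qc Qa) = 0 := by
    simp [Cmk, logdet]
  obtain ⟨ν, hν, he⟩ := intermediate_value_Icc (zero_le_one' ℝ) hcont
    (show τ ∈ Set.Icc _ _ from ⟨by simpa only [hz] using hτ0, by simpa only [one_smul] using hmin⟩)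
  refine ⟨ν, hν, hQ0.smul hν.1, ?_, he, ?_⟩
  · refine le_trans ?_ hpow
    have h0 : 0 ≤ Q0.trace.re := (Complex.nonneg_iff.1 hQ0.trace_nonneg).1
    simp only [Matrix.trace_add, Matrix.trace_smul, Complex.add_re, Complex.real_smul,
      Complex.re_ofReal_mul]
    nlinarith [hν.2]
  · intro Q0' Qc' Qa' h0 hc ha ht hm
    exact hopt Q0' Qc' Qa' h0 hc ha ht hm.ge
end

section
/- Let K ≥ 2, let H_k be an m_k × n complex matrix for k ∈ {1,…,K}. Let Q̂0, Q̂c, Q̂a be n×n Hermitian PSD matrices, let ξ ∈ (0,1), and let E be an n×n Hermitian PSD matrix satisfying H_k·E = 0 for every k ∈ {2,…,K} and Re(trace(E)) = (1−ξ)·Re(trace(Q̂0)). Define Q̄0 := ξ•Q̂0, Q̄c := Q̂c + E, Q̄a := Q̂a. Then: (i) Q̄0, Q̄c, Q̄a are Hermitian PSD; (ii) Re(trace(Q̄0+Q̄c+Q̄a)) = Re(trace(Q̂0+Q̂c+Q̂a)); (iii) C_b(Q̄c,Q̄a) ≥ C_b(Q̂c,Q̂a); (iv) C_{e,k}(Q̄c,Q̄a)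 = C_{e,k}(Q̂c,Q̂a) for every k ∈ {2,…,K}; and (v) C_{m,k}(Q̄0,Q̄c,Q̄a) ≤ C_{m,k}(Q̂0,Q̂c,Q̂a) for every k ∈ {1,…,K}. Consequently the secrecy objective satisfies f_s(Q̄c,Q̄a) ≥ f_s(Q̂c,Q̂a). -/
open Matrix ComplexOrder

theorem aux_det_ge_one {N : Type*} [Fintype N] [DecidableEq N] {X : Matrix N N ℂ}
    (hX : X.PosSemidef) : 1 ≤ (1 + X).det := by
  have hdet : (1 + X).det = ∏ i, (1 + (hX.1.eigenvalues i : ℂ)) := by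
    have h := hX.1.spectral_theorem
    rw [Unitary.conjStarAlgAut_apply] at h
    set U := hX.1.eigenvectorUnitary
    have h1 : (1 : Matrix N N ℂ) + X = (U : Matrix N N ℂ) *
        (1 + diagonal (RCLike.ofReal ∘ hX.1.eigenvalues)) * (star U : Matrix N N ℂ) := by
      rw [mul_add, add_mul, mul_one, ← h]
      simp
    have hu : ((U : Matrix N N ℂ)).det * ((star U : Matrix N N ℂ)).det = 1 := by
      rw [← det_mul]; simp
    rw [h1, det_mul, det_mul, mul_right_comm, hu, one_mul, ← diagonal_one, diagonal_add,
      det_diagonal]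
    rfl
  rw [hdet]
  have : (1 : ℝ) ≤ ∏ i, (1 + hX.1.eigenvalues i) := by
    have h := Finset.prod_le_prod (s := Finset.univ) (f := fun _ : N => (1 : ℝ))
      (g := fun i => 1 + hX.1.eigenvalues i) (fun _ _ => zero_le_one)
      (fun i _ => le_add_of_nonneg_right (hX.eigenvalues_nonneg i))
    simpa using h
  have h2 : ((1 : ℝ) : ℂ) ≤ ((∏ i, (1 + hX.1.eigenvalues i) : ℝ) : ℂ) :=
    Complex.real_le_real.2 this
  simpa using h2

open scoped MatrixOrder in
theorem aux_factor_s16 {N : Type*} [Fintype N] [DecidableEq N] {X : Matrix N N ℂ}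
    (hX : X.PosSemidef) : ∃ C : Matrix N N ℂ, X = C * Cᴴ := by
  obtain ⟨B, hB⟩ := (CStarAlgebra.nonneg_iff_eq_star_mul_self (a := X)).1 hX.nonneg
  exact ⟨Bᴴ, by simpa [star_eq_conjTranspose] using hB⟩

theorem aux_split {N : Type*} [Fintype N] [DecidableEq N] {A B : Matrix N N ℂ}
    (hA : A.PosDef) : (A + B).det = A.det * (1 + A⁻¹ * B).det := by
  rw [← det_mul, mul_add, mul_one, mul_nonsing_inv_cancel_left _ _
    ((isUnit_iff_isUnit_det A).1 hA.isUnit)]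

theorem aux_rank {N : Type*} [Fintype N] [DecidableEq N] {A C : Matrix N N ℂ} :
    (1 + A * (C * Cᴴ)).det = (1 + Cᴴ * A * C).det := by
  rw [← Matrix.mul_assoc, det_one_add_mul_comm, Matrix.mul_assoc]

theorem aux_mono_s16 {N : Type*} [Fintype N] [DecidableEq N] {A D : Matrix N N ℂ}
    (hA : A.PosDef) (hD : D.PosSemidef) : A.det ≤ (A + D).det := by
  obtain ⟨C, rfl⟩ := aux_factor_s16 hD
  rw [aux_split hA, aux_rank]
  exact le_mul_of_one_le_right hA.det_pos.le
    (aux_det_ge_one (hA.inv.posSemidef.conjTranspose_mul_mul_same C))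

theorem aux_pos_s16 {N : Type*} [Fintype N] [DecidableEq N] {A B : Matrix N N ℂ}
    (hA : A.PosDef) (hB : B.PosSemidef) : 0 < (1 + A⁻¹ * B).det := by
  have h := (hA.add_posSemidef hB).det_pos
  rw [aux_split hA] at h
  exact pos_of_mul_pos_right h hA.det_pos.le

theorem aux_mono_right {N : Type*} [Fintype N] [DecidableEq N] {A B D : Matrix N N ℂ}
    (hA : A.PosDef) (hB : B.PosSemidef) (hD : D.PosSemidef) :
    (1 + A⁻¹ * B).det ≤ (1 + A⁻¹ * (B + D)).det := by
  have h := aux_mono_s16 (hA.add_posSemidef hB) hD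
  rw [add_assoc, aux_split hA, aux_split hA] at h
  exact le_of_mul_le_mul_left h hA.det_pos

theorem aux_inv_s16 {N : Type*} [Fintype N] [DecidableEq N] {A B : Matrix N N ℂ}
    (hA : A.PosDef) (hB : B.PosSemidef) : (A⁻¹ - (A + B)⁻¹).PosSemidef := by
  have hP := hA.add_posSemidef hB
  have uA := (isUnit_iff_isUnit_det A).1 hA.isUnit
  have uP := (isUnit_iff_isUnit_det _).1 hP.isUnit
  have key : (A + B) * A⁻¹ * (A + B) - (A + B) = B + B * A⁻¹ * B := by
    rw [add_mul A B, mul_nonsing_inv _ uA, add_mul, mul_add (B * A⁻¹),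
      nonsing_inv_mul_cancel_right _ _ uA]
    noncomm_ring
  have h2 : A⁻¹ - (A + B)⁻¹ = (A + B)⁻¹ * (B + B * A⁻¹ * B) * ((A + B)⁻¹)ᴴ := by
    rw [hP.inv.1.eq, ← key, mul_sub, sub_mul, nonsing_inv_mul _ uP, one_mul,
      Matrix.mul_assoc (A + B), nonsing_inv_mul_cancel_left _ _ uP,
      mul_nonsing_inv_cancel_right _ _ uP]
  rw [h2]
  refine PosSemidef.mul_mul_conjTranspose_same (hB.add ?_) _
  have := hA.inv.posSemidef.mul_mul_conjTranspose_same B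
  rwa [hB.1.eq] at this

theorem aux_anti_left {N : Type*} [Fintype N] [DecidableEq N] {A B D : Matrix N N ℂ}
    (hA : A.PosDef) (hB : B.PosSemidef) (hD : D.PosSemidef) :
    (1 + (A + D)⁻¹ * B).det ≤ (1 + A⁻¹ * B).det := by
  obtain ⟨C, rfl⟩ := aux_factor_s16 hB
  rw [aux_rank, aux_rank]
  have h := aux_mono_s16 (A := 1 + Cᴴ * (A + D)⁻¹ * C)
    (PosDef.one.add_posSemidef
      ((hA.add_posSemidef hD).inv.posSemidef.conjTranspose_mul_mul_same C))
    ((aux_inv_s16 hA hD).conjTranspose_mul_mul_same C)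
  convert h using 2
  noncomm_ring

theorem aux_logdet {N : Type*} [Fintype N] [DecidableEq N] {X Y : Matrix N N ℂ}
    (h0 : 0 < X.det) (h : X.det ≤ Y.det) : logdet X ≤ logdet Y :=
  Real.log_le_log (Complex.pos_iff.1 h0).1 (Complex.le_def.1 h).1

theorem aux_Cek {p n : ℕ} (H : Matrix (Fin p) (Fin n) ℂ) {Qc Qa E : Matrix (Fin n) (Fin n) ℂ}
    (hQc : Qc.PosSemidef) (hQa : Qa.PosSemidef) (hE : E.PosSemidef) :
    Cek H Qc Qa ≤ Cek H (Qc + E) Qa := by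
  have hA : (1 + H * Qa * Hᴴ).PosDef :=
    PosDef.one.add_posSemidef (hQa.mul_mul_conjTranspose_same H)
  have hc := hQc.mul_mul_conjTranspose_same H
  unfold Cek
  rw [Matrix.mul_add, Matrix.add_mul]
  exact aux_logdet (aux_pos_s16 hA hc) (aux_mono_right hA hc (hE.mul_mul_conjTranspose_same H))

theorem aux_smul {n : ℕ} {Q : Matrix (Fin n) (Fin n) ℂ} (hQ : Q.PosSemidef) {r : ℝ}
    (hr : 0 ≤ r) : (r • Q).PosSemidef := hQ.smul hr

theorem aux_Cmk {p n : ℕ} (H : Matrix (Fin p) (Fin n) ℂ)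
    {Q0 Qc Qa E : Matrix (Fin n) (Fin n) ℂ} (hQ0 : Q0.PosSemidef)
    (hQc : Qc.PosSemidef) (hQa : Qa.PosSemidef) (hE : E.PosSemidef)
    (ξ : ℝ) (hξ : ξ ∈ Set.Ioo (0 : ℝ) 1) :
    Cmk H (ξ • Q0) (Qc + E) Qa ≤ Cmk H Q0 Qc Qa := by
  have hA : (1 + H * (Qc + Qa) * Hᴴ).PosDef :=
    PosDef.one.add_posSemidef ((hQc.add hQa).mul_mul_conjTranspose_same H)
  have hD := hE.mul_mul_conjTranspose_same H
  have h1 := (aux_smul hQ0 hξ.1.le).mul_mul_conjTranspose_same H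
  have h2 := (aux_smul hQ0 (sub_nonneg.2 hξ.2.le)).mul_mul_conjTranspose_same H
  have e1 : 1 + H * (Qc + E + Qa) * Hᴴ = (1 + H * (Qc + Qa) * Hᴴ) + H * E * Hᴴ := by
    rw [add_right_comm, Matrix.mul_add, Matrix.add_mul, add_assoc]
  have e2 : H * Q0 * Hᴴ = H * (ξ • Q0) * Hᴴ + H * ((1 - ξ) • Q0) * Hᴴ := by
    rw [← Matrix.add_mul, ← Matrix.mul_add, ← add_smul]; simp
  unfold Cmk
  rw [e1]
  refine aux_logdet (aux_pos_s16 (hA.add_posSemidef hD) h1) ?_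
  refine (aux_anti_left hA h1 hD).trans ?_
  rw [e2]
  exact aux_mono_right hA h1 h2

/-- The construction in the proof of Property 1 under Condition 2
(`N_t > Σ_{k≥2} N_{r,k}`): if the PSD matrix `E` satisfies `H_k E = 0` for every
unauthorized receiver `k` and `tr E = (1-ξ)·tr(Q̂0)`, then the new triple
`(ξ Q̂0, Q̂c + E, Q̂a)` is PSD, uses the same total power, does not decrease the
legitimate rate, leaves every eavesdropping rate unchanged, and does not increase any
multicast rate; consequently it does not decrease the secrecy objective `f_s`. -/
theorem stmt16 {n K : ℕ} (hK : 2 ≤ K) {p : Fin K → ℕ}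
    (H : (k : Fin K) → Matrix (Fin (p k)) (Fin n) ℂ)
    (Q0 Qc Qa : Matrix (Fin n) (Fin n) ℂ)
    (hQ0 : Q0.PosSemidef) (hQc : Qc.PosSemidef) (hQa : Qa.PosSemidef)
    (ξ : ℝ) (hξ : ξ ∈ Set.Ioo (0 : ℝ) 1)
    (E : Matrix (Fin n) (Fin n) ℂ) (hE : E.PosSemidef)
    (hEker : ∀ k : Fin K, k ≠ ⟨0, Nat.lt_of_lt_of_le Nat.zero_lt_two hK⟩ → H k * E = 0)
    (hEtr : (Matrix.trace E).re = (1 - ξ) * (Matrix.trace Q0).re) :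
    (ξ • Q0).PosSemidef ∧ (Qc + E).PosSemidef ∧ Qa.PosSemidef ∧
      (Matrix.trace (ξ • Q0 + (Qc + E) + Qa)).re = (Matrix.trace (Q0 + Qc + Qa)).re ∧
      Cek (H ⟨0, Nat.lt_of_lt_of_le Nat.zero_lt_two hK⟩) Qc Qa ≤
        Cek (H ⟨0, Nat.lt_of_lt_of_le Nat.zero_lt_two hK⟩) (Qc + E) Qa ∧
      (∀ k : Fin K, k ≠ ⟨0, Nat.lt_of_lt_of_le Nat.zero_lt_two hK⟩ →
        Cek (H k) (Qc + E) Qa = Cek (H k) Qc Qa) ∧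
      (∀ k : Fin K, Cmk (H k) (ξ • Q0) (Qc + E) Qa ≤ Cmk (H k) Q0 Qc Qa) ∧
      fsObj hK H Qc Qa ≤ fsObj hK H (Qc + E) Qa := by
  have hCeq : ∀ k : Fin K, k ≠ ⟨0, Nat.lt_of_lt_of_le Nat.zero_lt_two hK⟩ →
        Cek (H k) (Qc + E) Qa = Cek (H k) Qc Qa := by
    intro k hk
    unfold Cek
    rw [Matrix.mul_add, hEker k hk, add_zero]
  have hCb := aux_Cek (H ⟨0, Nat.lt_of_lt_of_le Nat.zero_lt_two hK⟩) hQc hQa hE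
  refine ⟨aux_smul hQ0 hξ.1.le, hQc.add hE, hQa, ?_, hCb, hCeq,
    fun k => aux_Cmk (H k) hQ0 hQc hQa hE ξ hξ, ?_⟩
  · simp only [trace_add, trace_smul, Complex.add_re, Complex.real_smul, Complex.re_ofReal_mul, hEtr]
    ring
  · unfold fsObj
    refine sub_le_sub hCb (le_of_eq ?_)
    exact Finset.sup'_congr _ rfl fun k hk => hCeq k (Finset.ne_of_mem_erase hk)
end

section
/- Let H be an m×n complex matrix and let Qa be an n×n Hermitian positive semidefinite complex matrix. Then I_m + H·Qa·Hᴴ is Hermitian positive definite, its inverse equals the unique maximizer guaranteed by the variational characterization of the log-determinant: the matrix S* := (I_m + H·Qa·Hᴴ)⁻¹ is Hermitian positive semidefinite and satisfies −Re(trace(S*·(I_m + H·Qa·Hᴴ))) + logdet(S*) + m = −logdet(I_m + H·Qa·Hᴴ), and for every m×m Hermitian positive definite S one has −Re(trace(S·(I_m + H·Qa·Hᴴ))) + logdet(S) + m ≤ −logdet(I_m + H·Qa·Hᴴ), where logdet X := Real.log ((Matrix.det X).re). -/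
open Matrix ComplexOrder

open scoped MatrixOrder Matrix.Norms.L2Operator in
lemma aux_factor_s17 {N : Type*} [Fintype N] [DecidableEq N] {S : Matrix N N ℂ} (hS : S.PosDef) :
    ∃ B : Matrix N N ℂ, IsUnit B ∧ S = star B * B :=
  CStarAlgebra.isStrictlyPositive_iff_eq_star_mul_self.mp hS.isStrictlyPositive

lemma aux_le {m : ℕ} {P : Matrix (Fin m) (Fin m) ℂ} (hP : P.PosDef) :
    Real.log P.det.re + m ≤ P.trace.re := by
  rw [hP.1.det_eq_prod_eigenvalues, hP.1.trace_eq_sum_eigenvalues]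
  have h1 : (∏ i, ((hP.1.eigenvalues i : ℝ) : ℂ)).re = ∏ i, hP.1.eigenvalues i := by
    rw [← Complex.ofReal_prod, Complex.ofReal_re]
  have h2 : (∑ i, ((hP.1.eigenvalues i : ℝ) : ℂ)).re = ∑ i, hP.1.eigenvalues i := by
    rw [← Complex.ofReal_sum, Complex.ofReal_re]
  refine le_of_eq_of_le (congrArg (fun x => Real.log x + (m : ℝ)) h1) (le_of_le_of_eq ?_ h2.symm)
  rw [Real.log_prod (fun i _ => (hP.eigenvalues_pos i).ne')]
  have h3 := Finset.sum_le_sum (s := Finset.univ)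
    (fun i _ => Real.log_le_sub_one_of_pos (hP.eigenvalues_pos i))
  simp only [Finset.sum_sub_distrib, Finset.sum_const, Finset.card_univ, Fintype.card_fin,
    nsmul_eq_mul, mul_one] at h3
  linarith

lemma aux_det {m : ℕ} {P : Matrix (Fin m) (Fin m) ℂ} (hP : P.PosDef) :
    0 < P.det.re ∧ P.det = (P.det.re : ℂ) := by
  have h := Complex.lt_def.mp hP.det_pos
  exact ⟨h.1, Complex.ext (by simp) (by simpa using h.2.symm)⟩

/-- Closed-form inner maximization of the AO algorithm (eq. (30a)):
`I + H Qa Hᴴ` is Hermitian positive definite, its inverse `S* = (I + H Qa Hᴴ)⁻¹` is PSD,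
attains `f(S*) = -logdet(I + H Qa Hᴴ)` for
`f(S) = -Re(tr(S (I + H Qa Hᴴ))) + logdet S + m`, and every Hermitian positive definite
`S` satisfies `f(S) ≤ -logdet(I + H Qa Hᴴ)`. -/
theorem stmt17 {m n : ℕ} (H : Matrix (Fin m) (Fin n) ℂ)
    (Qa : Matrix (Fin n) (Fin n) ℂ) (hQa : Qa.PosSemidef) :
    (1 + H * Qa * Hᴴ).PosDef ∧
      ((1 + H * Qa * Hᴴ)⁻¹).PosSemidef ∧
      (-(Matrix.trace ((1 + H * Qa * Hᴴ)⁻¹ * (1 + H * Qa * Hᴴ))).re +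
          logdet (1 + H * Qa * Hᴴ)⁻¹ + (m : ℝ) = -logdet (1 + H * Qa * Hᴴ)) ∧
      ∀ S : Matrix (Fin m) (Fin m) ℂ, S.PosDef →
        -(Matrix.trace (S * (1 + H * Qa * Hᴴ))).re + logdet S + (m : ℝ) ≤
          -logdet (1 + H * Qa * Hᴴ) := by
  have hE : (1 + H * Qa * Hᴴ).PosDef :=
    Matrix.PosDef.one.add_posSemidef (hQa.mul_mul_conjTranspose_same H)
  generalize (1 + H * Qa * Hᴴ) = E at hE ⊢
  obtain ⟨hd, he⟩ := aux_det hE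
  refine ⟨hE, hE.inv.posSemidef, ?_, ?_⟩
  · have hu : IsUnit E.det := isUnit_iff_ne_zero.mpr hE.det_pos.ne'
    rw [Matrix.nonsing_inv_mul _ hu]
    have h1 : (E⁻¹).det.re = (E.det.re)⁻¹ := by
      rw [Matrix.det_nonsing_inv, Ring.inverse_eq_inv', he, ← Complex.ofReal_inv]
      simp
    unfold logdet
    rw [h1, Real.log_inv]
    simp
  · intro S hS
    obtain ⟨hs, hs'⟩ := aux_det hS
    obtain ⟨B, hB, hSB⟩ := aux_factor_s17 hS
    have hP : (B * E * star B).PosDef := (Matrix.IsUnit.posDef_star_right_conjugate_iff hB).mpr hE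
    have h := aux_le hP
    have ht : (B * E * star B).trace = (S * E).trace := by
      rw [Matrix.trace_mul_cycle, hSB]
    have hdet : (B * E * star B).det.re = S.det.re * E.det.re := by
      have : (B * E * star B).det = S.det * E.det := by
        rw [hSB]; simp only [Matrix.det_mul]; ring
      rw [this, hs', he, ← Complex.ofReal_mul]
      simp
    rw [ht, hdet, Real.log_mul hs.ne' hd.ne'] at h
    unfold logdet
    linarith
end
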